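/- For all integers n ≥ 0, A_{5,3}(25n + 22) ≡ 0 (mod 5). -/

import Mathlib

/-- Hook length of the cell in row `i`, column `j` (0-indexed) of the
Ferrers–Young diagram of the partition `p` (rows sorted in decreasing order). -/
def hookLength {n : ℕ} (p : n.Partition) (i j : ℕ) : ℕ :=
  (((p.parts.sort (· ≤ ·)).reverse.getD i 0 - j) +
    ((p.parts.filter (fun x => j < x)).card - i)) - 1

/-- A partition is a `t`-core if no hook number of its Ferrers–Young diagram is
divisible by `t`. -/
def IsTCore (t : ℕ) {n : ℕ} (p : n.Partition) : Prop :=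
  ∀ i j : ℕ, j < (p.parts.sort (· ≤ ·)).reverse.getD i 0 → ¬ t ∣ hookLength p i j

/-- `numA t k n` is the number of `k`-tuples of `t`-core partitions whose sizes sum to `n`. -/
noncomputable def numA (t k n : ℕ) : ℕ :=
  Nat.card { f : Fin k → Σ m : Fin (n + 1), Nat.Partition (m : ℕ) //
    (∑ i, ((f i).1 : ℕ)) = n ∧ ∀ i, IsTCore t (f i).2 }


instance factPrimeFive : Fact (Nat.Prime 5) := ⟨by norm_num⟩

section PentagonalDissection
open PowerSeries Finset

theorem natAbs_le_pentagonal (j : ℤ) : j.natAbs ≤ pentagonal j := by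
  have h := two_mul_natCast_pentagonal j
  zify
  rcases abs_cases j with ⟨h1, h2⟩ | ⟨h1, h2⟩ <;> rw [h1]
  · rcases h2.eq_or_lt with h2 | h2
    · omega
    · nlinarith
  · nlinarith

theorem pentagonal_mod_five (j : ℤ) :
    ((j % 5 = 0 ∨ j % 5 = 2) → pentagonal j % 5 = 0) ∧ (j % 5 = 1 → pentagonal j % 5 = 1) ∧
      ((j % 5 = 3 ∨ j % 5 = 4) → pentagonal j % 5 = 2) := by
  have h := two_mul_natCast_pentagonal j
  have key : ∀ r : ℤ, j % 5 = r → (2 * (pentagonal j : ℤ)) % 5 = (r * (3 * r - 1)) % 5 := by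
    rintro r rfl
    rw [h]
    apply Int.ModEq.mul (Int.mod_modEq _ _).symm
    exact ((Int.mod_modEq _ _).symm.mul_left 3).sub_right 1
  refine ⟨?_, ?_, ?_⟩
  · rintro (h | h) <;> have := key _ h <;> omega
  · intro h; have := key _ h; omega
  · rintro (h | h) <;> have := key _ h <;> omega

/-- The part of the pentagonal series indexed by the integers congruent to `r` modulo `5`. -/
noncomputable def pentagonalPart (r : ℤ) : (ZMod 5)⟦X⟧ :=
  mk fun n ↦ ∑ j ∈ Icc (-n : ℤ) n,
    if j % 5 = r ∧ pentagonal j = n then ((Int.negOnePow j : ℤ) : ZMod 5) else 0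

theorem coeff_pentagonalPart_of_le (r : ℤ) {n N : ℕ} (h : n ≤ N) :
    coeff n (pentagonalPart r) = ∑ j ∈ Icc (-N : ℤ) N,
      if j % 5 = r ∧ pentagonal j = n then ((Int.negOnePow j : ℤ) : ZMod 5) else 0 := by
  rw [pentagonalPart, coeff_mk]
  apply sum_subset
  · intro j; simp only [mem_Icc]; omega
  · intro j _ hj
    rw [if_neg]
    rintro ⟨-, h2⟩
    have := natAbs_le_pentagonal j
    simp only [mem_Icc] at hj
    omega

theorem coeff_pentagonalPart_mul (r s : ℤ) (N : ℕ) :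
    coeff N (pentagonalPart r * pentagonalPart s) =
      ∑ p ∈ Icc (-N : ℤ) N ×ˢ Icc (-N : ℤ) N,
        if (p.1 % 5 = r ∧ p.2 % 5 = s) ∧ pentagonal p.1 + pentagonal p.2 = N then
          ((Int.negOnePow (p.1 + p.2) : ℤ) : ZMod 5) else 0 := by
  rw [coeff_mul]
  have : ∀ p ∈ antidiagonal N, coeff p.1 (pentagonalPart r) * coeff p.2 (pentagonalPart s) =
      ∑ q ∈ Icc (-N : ℤ) N ×ˢ Icc (-N : ℤ) N,
        if (q.1 % 5 = r ∧ q.2 % 5 = s) ∧ (pentagonal q.1, pentagonal q.2) = p then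
          ((Int.negOnePow (q.1 + q.2) : ℤ) : ZMod 5) else 0 := by
    rintro ⟨a, b⟩ hp
    rw [HasAntidiagonal.mem_antidiagonal] at hp
    simp only at hp ⊢
    rw [coeff_pentagonalPart_of_le r (show a ≤ N by omega),
      coeff_pentagonalPart_of_le s (show b ≤ N by omega), sum_mul_sum, sum_product]
    refine sum_congr rfl fun j _ ↦ sum_congr rfl fun k _ ↦ ?_
    simp only [Prod.mk.injEq]
    rw [ite_zero_mul_ite_zero]
    refine if_congr (by tauto) ?_ rfl
    rw [Int.negOnePow_add]
    push_cast
    rfl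
  rw [sum_congr rfl this, sum_comm]
  refine sum_congr rfl fun q _ ↦ ?_
  by_cases h : q.1 % 5 = r ∧ q.2 % 5 = s
  · simp [h, sum_ite_eq]
  · simp [h]

theorem sum_pentagonalPart :
    pentagonalSeries (ZMod 5) = pentagonalPart 0 + pentagonalPart 1 + pentagonalPart 2 +
      pentagonalPart 3 + pentagonalPart 4 := by
  ext n
  simp only [map_add, pentagonalPart, coeff_mk, ← sum_add_distrib]
  have : ∀ j : ℤ, ((((if j % 5 = 0 ∧ pentagonal j = n then ((Int.negOnePow j : ℤ) : ZMod 5) else 0) +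
      (if j % 5 = 1 ∧ pentagonal j = n then ((Int.negOnePow j : ℤ) : ZMod 5) else 0)) +
      (if j % 5 = 2 ∧ pentagonal j = n then ((Int.negOnePow j : ℤ) : ZMod 5) else 0)) +
      (if j % 5 = 3 ∧ pentagonal j = n then ((Int.negOnePow j : ℤ) : ZMod 5) else 0)) +
      (if j % 5 = 4 ∧ pentagonal j = n then ((Int.negOnePow j : ℤ) : ZMod 5) else 0) =
      if pentagonal j = n then ((Int.negOnePow j : ℤ) : ZMod 5) else 0 := by
    intro j
    by_cases hn : pentagonal j = n
    · have : j % 5 = 0 ∨ j % 5 = 1 ∨ j % 5 = 2 ∨ j % 5 = 3 ∨ j % 5 = 4 := by omega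
      rcases this with h | h | h | h | h <;> simp [h, hn]
    · simp [hn]
  rw [sum_congr rfl fun j _ ↦ this j]
  by_cases hn : n ∈ Set.range pentagonal
  · obtain ⟨k, rfl⟩ := hn
    rw [coeff_pentagonalSeries_pentagonal]
    simp only [pentagonal_inj]
    rw [sum_ite_eq', if_pos]
    have := natAbs_le_pentagonal k
    simp only [mem_Icc]; omega
  · rw [coeff_pentagonalSeries_eq_zero _ hn, sum_eq_zero]
    intro j _
    rw [if_neg fun h ↦ hn ⟨j, h⟩]

/-- The reflection of `ℤ × ℤ` coming from multiplication of conjugates by `(3 - 4 * i) / 5` on the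
Gaussian integers `(6 * j - 1) + (6 * k - 1) * i`. -/
def gaussianReflection (p : ℤ × ℤ) : ℤ × ℤ :=
  ((3 * p.1 - 4 * p.2 + 1) / 5, (-4 * p.1 - 3 * p.2 + 2) / 5)

theorem pentagonalPart_relation :
    pentagonalPart 0 * pentagonalPart 4 + pentagonalPart 1 * pentagonalPart 1 +
      pentagonalPart 2 * pentagonalPart 3 + pentagonalPart 3 * pentagonalPart 0 +
      pentagonalPart 4 * pentagonalPart 2 = 0 := by
  ext N
  simp only [map_add, coeff_pentagonalPart_mul, ← sum_add_distrib, map_zero]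
  have : ∀ p : ℤ × ℤ,
      ((((if (p.1 % 5 = 0 ∧ p.2 % 5 = 4) ∧ pentagonal p.1 + pentagonal p.2 = N then
        ((Int.negOnePow (p.1 + p.2) : ℤ) : ZMod 5) else 0) +
      (if (p.1 % 5 = 1 ∧ p.2 % 5 = 1) ∧ pentagonal p.1 + pentagonal p.2 = N then
        ((Int.negOnePow (p.1 + p.2) : ℤ) : ZMod 5) else 0)) +
      (if (p.1 % 5 = 2 ∧ p.2 % 5 = 3) ∧ pentagonal p.1 + pentagonal p.2 = N then
        ((Int.negOnePow (p.1 + p.2) : ℤ) : ZMod 5) else 0)) +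
      (if (p.1 % 5 = 3 ∧ p.2 % 5 = 0) ∧ pentagonal p.1 + pentagonal p.2 = N then
        ((Int.negOnePow (p.1 + p.2) : ℤ) : ZMod 5) else 0)) +
      (if (p.1 % 5 = 4 ∧ p.2 % 5 = 2) ∧ pentagonal p.1 + pentagonal p.2 = N then
        ((Int.negOnePow (p.1 + p.2) : ℤ) : ZMod 5) else 0) =
      if (p.2 - 2 * p.1 + 1) % 5 = 0 ∧ pentagonal p.1 + pentagonal p.2 = N then
        ((Int.negOnePow (p.1 + p.2) : ℤ) : ZMod 5) else 0 := by
    rintro ⟨j, k⟩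
    simp only
    by_cases hn : pentagonal j + pentagonal k = N
    · have : j % 5 = 0 ∨ j % 5 = 1 ∨ j % 5 = 2 ∨ j % 5 = 3 ∨ j % 5 = 4 := by omega
      rcases this with h | h | h | h | h <;> simp [h, hn] <;> refine if_congr ?_ rfl rfl <;> omega
    · simp [hn]
  rw [sum_congr rfl fun p _ ↦ this p, ← sum_filter]
  have inv : ∀ p : ℤ × ℤ, (p.2 - 2 * p.1 + 1) % 5 = 0 →
      ∃ u v : ℤ, gaussianReflection p = (u, v) ∧
        5 * u = 3 * p.1 - 4 * p.2 + 1 ∧ 5 * v = -4 * p.1 - 3 * p.2 + 2 := by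
    rintro ⟨j, k⟩ h
    refine ⟨_, _, rfl, ?_, ?_⟩ <;> simp only at h ⊢ <;> omega
  refine sum_involution (fun p _ ↦ gaussianReflection p) ?_ ?_ ?_ ?_
  · rintro ⟨j, k⟩ hp
    simp only [mem_filter, mem_product, mem_Icc] at hp
    obtain ⟨u, v, huv, hu, hv⟩ := inv (j, k) hp.2.1
    simp only at hu hv
    rw [huv]
    have : Odd (j + k + (u + v)) := by rw [Int.odd_iff]; omega
    have h2 := Int.negOnePow_odd _ this
    rw [Int.negOnePow_add (j + k)] at h2
    simp only
    rcases Int.even_or_odd (u + v) with h3 | h3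
    · rw [Int.negOnePow_even _ h3, mul_one] at h2
      rw [h2, Int.negOnePow_even _ h3]; simp
    · rw [Int.negOnePow_odd _ h3, mul_neg, mul_one, neg_inj] at h2
      rw [h2, Int.negOnePow_odd _ h3]; simp
  · rintro ⟨j, k⟩ hp - heq
    simp only [mem_filter, mem_product, mem_Icc] at hp
    obtain ⟨u, v, huv, hu, hv⟩ := inv (j, k) hp.2.1
    rw [huv, Prod.mk.injEq] at heq
    simp only at hu hv
    omega
  · rintro ⟨j, k⟩ hp
    simp only [mem_filter, mem_product, mem_Icc] at hp
    obtain ⟨u, v, huv, hu, hv⟩ := inv (j, k) hp.2.1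
    simp only at hu hv
    rw [huv]
    simp only [mem_filter, mem_product, mem_Icc]
    have hpent : pentagonal u + pentagonal v = N := by
      rw [← hp.2.2]
      zify
      have h1 := two_mul_natCast_pentagonal u
      have h2 := two_mul_natCast_pentagonal v
      have h3 := two_mul_natCast_pentagonal j
      have h4 := two_mul_natCast_pentagonal k
      have : 50 * ((pentagonal u : ℤ) + pentagonal v) = 50 * (pentagonal j + pentagonal k) := by
        have e1 : 50 * ((pentagonal u : ℤ) + pentagonal v) =
          (5 * u) * (3 * (5 * u) - 5) + (5 * v) * (3 * (5 * v) - 5) := by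
          linear_combination 25 * h1 + 25 * h2
        rw [e1, hu, hv]
        linear_combination -25 * h3 - 25 * h4
      omega
    have b1 := natAbs_le_pentagonal u
    have b2 := natAbs_le_pentagonal v
    refine ⟨?_, ?_, hpent⟩ <;> omega
  · rintro ⟨j, k⟩ hp
    simp only [mem_filter, mem_product, mem_Icc] at hp
    obtain ⟨u, v, huv, hu, hv⟩ := inv (j, k) hp.2.1
    simp only at hu hv
    simp only [huv]
    rw [gaussianReflection, Prod.mk.injEq]
    constructor <;> simp only <;> omega

theorem pentagonal_one_sub_five_mul (l : ℤ) : pentagonal (1 - 5 * l) = 25 * pentagonal l + 1 := by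
  have h1 := two_mul_natCast_pentagonal l
  have h2 := two_mul_natCast_pentagonal (1 - 5 * l)
  zify
  linarith

theorem pentagonalPart_one :
    pentagonalPart 1 = -X * expand 25 (by norm_num) (pentagonalSeries (ZMod 5)) := by
  ext n
  have key : ∀ k : ℤ, coeff (pentagonal k) (pentagonalPart 1) =
      if k % 5 = 1 then ((Int.negOnePow k : ℤ) : ZMod 5) else 0 := by
    intro k
    simp only [pentagonalPart, coeff_mk, pentagonal_inj]
    rw [sum_eq_single k]
    · simp
    · intro b _ hb; simp [hb]
    · intro hk
      have := natAbs_le_pentagonal k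
      simp only [mem_Icc] at hk
      omega
  rw [neg_mul, map_neg]
  by_cases hn : ∃ l : ℤ, n = 25 * pentagonal l + 1
  · obtain ⟨l, rfl⟩ := hn
    rw [coeff_succ_X_mul, coeff_expand_mul, coeff_pentagonalSeries_pentagonal,
      ← pentagonal_one_sub_five_mul, key, if_pos (by omega), Int.negOnePow_sub]
    have : Int.negOnePow (5 * l) = Int.negOnePow l := by
      rw [Int.negOnePow_eq_iff]; exact ⟨2 * l, by ring⟩
    simp [this]
  · have h1 : coeff n (pentagonalPart 1) = 0 := by
      simp only [pentagonalPart, coeff_mk]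
      apply sum_eq_zero
      intro j _
      rw [if_neg]
      rintro ⟨h1, rfl⟩
      refine hn ⟨(1 - j) / 5, ?_⟩
      rw [← pentagonal_one_sub_five_mul]
      congr 1; omega
    rw [h1]
    rcases n with _ | n
    · simp
    · rw [coeff_succ_X_mul, coeff_expand]
      split_ifs with hd
      · rw [coeff_pentagonalSeries_eq_zero, neg_zero]
        rintro ⟨l, hl⟩
        exact hn ⟨l, by omega⟩
      · simp

/-- All exponents of the power series `f` are congruent to `r` modulo `5`. -/
def SupportedModFive (r : ℕ) (f : (ZMod 5)⟦X⟧) : Prop :=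
  ∀ n, n % 5 ≠ r % 5 → coeff n f = 0

theorem SupportedModFive.mul {r s : ℕ} {f g : (ZMod 5)⟦X⟧} (hf : SupportedModFive r f)
    (hg : SupportedModFive s g) : SupportedModFive (r + s) (f * g) := by
  intro n hn
  rw [coeff_mul]
  refine sum_eq_zero fun p hp ↦ ?_
  rw [HasAntidiagonal.mem_antidiagonal] at hp
  by_cases h1 : p.1 % 5 = r % 5
  · rw [hg p.2 (by omega), mul_zero]
  · rw [hf p.1 h1, zero_mul]

theorem SupportedModFive.add {r : ℕ} {f g : (ZMod 5)⟦X⟧} (hf : SupportedModFive r f)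
    (hg : SupportedModFive r g) : SupportedModFive r (f + g) := by
  intro n hn
  rw [map_add, hf n hn, hg n hn, add_zero]

theorem supportedModFive_expand (f : (ZMod 5)⟦X⟧) :
    SupportedModFive 0 (expand 5 (by norm_num) f) := by
  intro n hn
  rw [coeff_expand_of_not_dvd]
  omega

theorem supportedModFive_pentagonalPart (r : ℤ) (s : ℕ)
    (h : ∀ j : ℤ, j % 5 = r → pentagonal j % 5 = s % 5) :
    SupportedModFive s (pentagonalPart r) := by
  intro n hn
  rw [pentagonalPart, coeff_mk]
  refine sum_eq_zero fun j _ ↦ if_neg ?_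
  rintro ⟨h1, rfl⟩
  exact hn (h j h1)

theorem pentagonalSeries_pow_five :
    pentagonalSeries (ZMod 5) ^ 5 = expand 5 (by norm_num) (pentagonalSeries (ZMod 5)) := by
  have h := MvPowerSeries.map_frobenius_expand (σ := Unit) (R := ZMod 5) 5 (by norm_num)
    (f := pentagonalSeries (ZMod 5))
  rw [ZMod.frobenius_zmod, MvPowerSeries.map_id] at h
  exact h.symm

theorem exists_pentagonal_dissection : ∃ a b c : (ZMod 5)⟦X⟧,
    pentagonalSeries (ZMod 5) = a + b + c ∧ a * c = -b ^ 2 ∧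
      b = -X * expand 25 (by norm_num) (pentagonalSeries (ZMod 5)) ∧
      SupportedModFive 0 a ∧ SupportedModFive 1 b ∧ SupportedModFive 2 c := by
  refine ⟨pentagonalPart 0 + pentagonalPart 2, pentagonalPart 1,
    pentagonalPart 3 + pentagonalPart 4, ?_, ?_, pentagonalPart_one, ?_, ?_, ?_⟩
  · rw [sum_pentagonalPart]; ring
  · linear_combination pentagonalPart_relation
  · exact (supportedModFive_pentagonalPart 0 0 fun j h ↦ (pentagonal_mod_five j).1 (.inl h)).add
      (supportedModFive_pentagonalPart 2 0 fun j h ↦ (pentagonal_mod_five j).1 (.inr h))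
  · exact supportedModFive_pentagonalPart 1 1 fun j h ↦ (pentagonal_mod_five j).2.1 h
  · exact (supportedModFive_pentagonalPart 3 2 fun j h ↦ (pentagonal_mod_five j).2.2 (.inl h)).add
      (supportedModFive_pentagonalPart 4 2 fun j h ↦ (pentagonal_mod_five j).2.2 (.inr h))

theorem supportedModFive_natCast (k : ℕ) : SupportedModFive 0 (k : (ZMod 5)⟦X⟧) := by
  intro n hn
  rw [← map_natCast (C (R := ZMod 5)), coeff_C, if_neg]
  rintro rfl
  exact hn rfl

theorem five_eq_zero_zmod_powerSeries : (5 : (ZMod 5)⟦X⟧) = 0 := by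
  have h : (5 : ZMod 5) = 0 := rfl
  rw [← map_ofNat (C (R := ZMod 5)) 5, h, map_zero]

theorem coeff_expand_five_mul_pentagonalSeries_pow_four (f : (ZMod 5)⟦X⟧) (n : ℕ) :
    coeff (5 * n + 4) (expand 5 (by norm_num) f * pentagonalSeries (ZMod 5) ^ 4) = 0 := by
  obtain ⟨a, b, c, hE, hac, -, ha, hb, hc⟩ := exists_pentagonal_dissection
  have hf := supportedModFive_expand f
  have hk := supportedModFive_natCast
  set F := expand 5 (by norm_num) f
  have e : F * pentagonalSeries (ZMod 5) ^ 4 =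
      F * (a * a * (a * a) + (12 : ℕ) * (a * b * (c * c)) + (4 : ℕ) * (b * b * (b * c))) +
      F * ((4 : ℕ) * (a * a * (a * b)) + (4 : ℕ) * (a * c * (c * c)) +
        (6 : ℕ) * (b * b * (c * c))) +
      F * ((4 : ℕ) * (a * a * (a * c)) + (6 : ℕ) * (a * a * (b * b)) +
        (4 : ℕ) * (b * c * (c * c))) +
      F * ((12 : ℕ) * (a * a * (b * c)) + (4 : ℕ) * (a * b * (b * b)) + c * c * (c * c)) := by
    rw [hE]
    push_cast
    linear_combination F * (6 * a * c + 6 * b ^ 2) * hac -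
      F * b ^ 4 * five_eq_zero_zmod_powerSeries
  have h0 : SupportedModFive 0
      (F * (a * a * (a * a) + (12 : ℕ) * (a * b * (c * c)) + (4 : ℕ) * (b * b * (b * c)))) :=
    hf.mul ((((ha.mul ha).mul (ha.mul ha)).add
      ((hk 12).mul ((ha.mul hb).mul (hc.mul hc)))).add ((hk 4).mul ((hb.mul hb).mul (hb.mul hc))))
  have h1 : SupportedModFive 1
      (F * ((4 : ℕ) * (a * a * (a * b)) + (4 : ℕ) * (a * c * (c * c)) +
        (6 : ℕ) * (b * b * (c * c)))) :=
    hf.mul ((((hk 4).mul ((ha.mul ha).mul (ha.mul hb))).add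
      ((hk 4).mul ((ha.mul hc).mul (hc.mul hc)))).add ((hk 6).mul ((hb.mul hb).mul (hc.mul hc))))
  have h2 : SupportedModFive 2
      (F * ((4 : ℕ) * (a * a * (a * c)) + (6 : ℕ) * (a * a * (b * b)) +
        (4 : ℕ) * (b * c * (c * c)))) :=
    hf.mul ((((hk 4).mul ((ha.mul ha).mul (ha.mul hc))).add
      ((hk 6).mul ((ha.mul ha).mul (hb.mul hb)))).add ((hk 4).mul ((hb.mul hc).mul (hc.mul hc))))
  have h3 : SupportedModFive 3
      (F * ((12 : ℕ) * (a * a * (b * c)) + (4 : ℕ) * (a * b * (b * b)) + c * c * (c * c))) :=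
    hf.mul ((((hk 12).mul ((ha.mul ha).mul (hb.mul hc))).add
      ((hk 4).mul ((ha.mul hb).mul (hb.mul hb)))).add ((hc.mul hc).mul (hc.mul hc)))
  rw [e, map_add, map_add, map_add, h0 _ (by omega), h1 _ (by omega), h2 _ (by omega),
    h3 _ (by omega)]
  simp

theorem coeff_pentagonalSeries_pow_seventyTwo (n : ℕ) :
    coeff (25 * n + 22) (pentagonalSeries (ZMod 5) ^ 72) = 0 := by
  obtain ⟨a, b, c, hE, hac, hb', ha, hb, hc⟩ := exists_pentagonal_dissection
  have h25 : expand 25 (by norm_num) (pentagonalSeries (ZMod 5)) =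
      expand 5 (by norm_num) (expand 5 (by norm_num) (pentagonalSeries (ZMod 5))) :=
    expand_mul 5 (by norm_num) 5 (by norm_num) _
  set F := expand 5 (by norm_num) (pentagonalSeries (ZMod 5) ^ 14)
  have hf : SupportedModFive 0 F := supportedModFive_expand _
  have hk := supportedModFive_natCast 2
  have e : pentagonalSeries (ZMod 5) ^ 72 = F * (a * a) + F * ((2 : ℕ) * (a * b)) +
      F * ((2 : ℕ) * (b * c)) + F * (c * c) + F * (-b ^ 2) := by
    have h1 : pentagonalSeries (ZMod 5) ^ 72 = F * pentagonalSeries (ZMod 5) ^ 2 := by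
      rw [show F = (pentagonalSeries (ZMod 5) ^ 5) ^ 14 by
        rw [pentagonalSeries_pow_five, ← map_pow]]
      ring
    rw [h1, hE]
    push_cast
    linear_combination 2 * F * hac
  have h0 : SupportedModFive 0 (F * (a * a)) := hf.mul (ha.mul ha)
  have h1 : SupportedModFive 1 (F * ((2 : ℕ) * (a * b))) := hf.mul (hk.mul (ha.mul hb))
  have h3 : SupportedModFive 3 (F * ((2 : ℕ) * (b * c))) := hf.mul (hk.mul (hb.mul hc))
  have h4 : SupportedModFive 4 (F * (c * c)) := hf.mul (hc.mul hc)
  have h2 : F * (-b ^ 2) = -(X ^ 2 * expand 5 (by norm_num)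
      (expand 5 (by norm_num) (pentagonalSeries (ZMod 5) ^ 4) *
        pentagonalSeries (ZMod 5) ^ 4)) := by
    rw [hb', h25, show F = expand 5 (by norm_num) (pentagonalSeries (ZMod 5) ^ 14) from rfl]
    have : pentagonalSeries (ZMod 5) ^ 14 =
        expand 5 (by norm_num) (pentagonalSeries (ZMod 5)) ^ 2 * pentagonalSeries (ZMod 5) ^ 4 := by
      rw [← pentagonalSeries_pow_five]; ring
    rw [this]
    simp only [map_mul, map_pow]
    ring
  rw [e, h2]
  simp only [map_add, map_neg]
  rw [h0 _ (by omega), h1 _ (by omega), h3 _ (by omega), h4 _ (by omega),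
    show 25 * n + 22 = 5 * (5 * n + 4) + 2 by ring, coeff_X_pow_mul, coeff_expand_mul,
    coeff_expand_five_mul_pentagonalSeries_pow_four]
  simp

end PentagonalDissection

section EulerIdentity
open PowerSeries Finset

variable {R : Type*} [CommRing R]

/-- Euler's series `∑ q ^ (k choose 2) z ^ k / ((1 - q) ⋯ (1 - q ^ k))`, where `D k` stands for the
reciprocal of the denominator. -/
noncomputable def eulerSeries (q : R) (D : ℕ → R) : R⟦X⟧ :=
  mk fun k ↦ q ^ k.choose 2 * D k

theorem eulerSeries_eq {q : R} {D : ℕ → R} (hD : ∀ k, D (k + 1) * (1 - q ^ (k + 1)) = D k) :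
    eulerSeries q D = (1 + X) * rescale q (eulerSeries q D) := by
  ext n
  rw [add_mul, one_mul, map_add, coeff_rescale]
  rcases n with _ | n
  · simp
  · rw [coeff_succ_X_mul, coeff_rescale]
    simp only [eulerSeries, coeff_mk]
    rw [Nat.choose_succ_succ' n 1, Nat.choose_one_right, ← hD n]
    ring

theorem coeff_eq_of_eq_one_add_X_mul_rescale {q : R} {D : ℕ → R} (hD0 : D 0 = 1)
    (hD : ∀ k, D (k + 1) * (1 - q ^ (k + 1)) = D k)
    (hq : ∀ k, IsLeftRegular (1 - q ^ (k + 1)))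
    {g : R⟦X⟧} (hg0 : constantCoeff g = 1) (hg : g = (1 + X) * rescale q g) (n : ℕ) :
    coeff n g = q ^ n.choose 2 * D n := by
  induction n with
  | zero => simp [hg0, hD0]
  | succ n ih =>
    apply hq n
    have h := congrArg (coeff (n + 1)) hg
    rw [add_mul, one_mul, map_add, coeff_rescale, coeff_succ_X_mul, coeff_rescale, ih] at h
    simp only
    rw [Nat.choose_succ_succ' n 1, Nat.choose_one_right]
    linear_combination h - q ^ (n + n.choose 2) * hD n

/-- The sum of the bead positions of the abacus with five runners, the `i`-th of which carries
`c i` beads pushed to the top. -/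
def abacusSum (c : Fin 5 →₀ ℕ) : ℕ :=
  ∑ i : Fin 5, ((i : ℕ) * c i + 5 * (c i).choose 2)

theorem sum_prod_eq_of_dissection {q : R} {D D' : ℕ → R} (hD0 : D 0 = 1) (hD'0 : D' 0 = 1)
    (hD : ∀ k, D (k + 1) * (1 - q ^ (k + 1)) = D k)
    (hD' : ∀ k, D' (k + 1) * (1 - (q ^ 5) ^ (k + 1)) = D' k)
    (hq : ∀ k, IsLeftRegular (1 - q ^ (k + 1))) (N : ℕ) :
    ∑ c ∈ finsuppAntidiag (univ : Finset (Fin 5)) N,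
      q ^ abacusSum c * ∏ i, D' (c i) =
      q ^ N.choose 2 * D N := by
  set f := eulerSeries (q ^ 5) D'
  have hf : f = (1 + X) * rescale (q ^ 5) f := eulerSeries_eq hD'
  have hf0 : constantCoeff f = 1 := by
    rw [← coeff_zero_eq_constantCoeff_apply]; simp [f, eulerSeries, hD'0]
  have hg : ∏ i : Fin 5, rescale (q ^ (i : ℕ)) f =
      (1 + X) * rescale q (∏ i : Fin 5, rescale (q ^ (i : ℕ)) f) := by
    simp only [Fin.prod_univ_five, map_mul, rescale_rescale]
    simp only [Fin.coe_ofNat_eq_mod, Nat.reduceMod, pow_zero, one_mul, rescale_one, RingHom.id_apply,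
      ← pow_succ, pow_one, Nat.reduceAdd]
    rw [← sq q]
    linear_combination (rescale q f * rescale (q ^ 2) f * rescale (q ^ 3) f * rescale (q ^ 4) f) * hf
  rw [← coeff_eq_of_eq_one_add_X_mul_rescale hD0 hD hq ?_ hg N, coeff_prod]
  · refine sum_congr rfl fun c _ ↦ ?_
    simp only [coeff_rescale, f, eulerSeries, coeff_mk]
    rw [abacusSum, ← prod_pow_eq_pow_sum, ← prod_mul_distrib]
    refine prod_congr rfl fun i _ ↦ ?_
    ring
  · rw [map_prod]
    refine prod_eq_one fun i _ ↦ ?_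
    rw [← coeff_zero_eq_constantCoeff_apply, coeff_rescale]
    simp [hf0]

end EulerIdentity

section CoreSeries
open PowerSeries Finset

theorem two_mul_choose_two (n : ℕ) : 2 * (n.choose 2 : ℤ) = n * (n - 1) := by
  have h := Nat.choose_two_right n
  have h2 : 2 ∣ n * (n - 1) := (Nat.even_mul_pred_self n).two_dvd
  rcases n with _ | n
  · simp
  · have : 2 * (n + 1).choose 2 = (n + 1) * n := by
      rw [h]; exact Nat.mul_div_cancel' h2
    push_cast
    have h3 : 2 * ((n + 1).choose 2 : ℤ) = (n + 1) * n := by exact_mod_cast this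
    rw [h3]; ring

theorem abacusSum_bounds {M : ℕ} {c : Fin 5 →₀ ℕ}
    (hc : c ∈ finsuppAntidiag (univ : Finset (Fin 5)) (5 * M)) :
    (5 * M).choose 2 ≤ abacusSum c ∧
      ∀ i, M ≤ c i + 2 * (abacusSum c - (5 * M).choose 2) := by
  rw [mem_finsuppAntidiag] at hc
  have hs := hc.1
  simp only [Fin.sum_univ_five] at hs
  have hN := two_mul_choose_two (5 * M)
  have h0 := two_mul_choose_two (c 0)
  have h1 := two_mul_choose_two (c 1)
  have h2 := two_mul_choose_two (c 2)
  have h3 := two_mul_choose_two (c 3)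
  have h4 := two_mul_choose_two (c 4)
  have hW : (abacusSum c : ℤ) = c 1 + 2 * c 2 + 3 * c 3 + 4 * c 4 + 5 * ((c 0).choose 2 +
      (c 1).choose 2 + (c 2).choose 2 + (c 3).choose 2 + (c 4).choose 2) := by
    simp [abacusSum, Fin.sum_univ_five]; ring
  obtain ⟨n0, e0⟩ : ∃ n : ℤ, (c 0 : ℤ) = M + n := ⟨c 0 - M, by ring⟩
  obtain ⟨n1, e1⟩ : ∃ n : ℤ, (c 1 : ℤ) = M + n := ⟨c 1 - M, by ring⟩
  obtain ⟨n2, e2⟩ : ∃ n : ℤ, (c 2 : ℤ) = M + n := ⟨c 2 - M, by ring⟩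
  obtain ⟨n3, e3⟩ : ∃ n : ℤ, (c 3 : ℤ) = M + n := ⟨c 3 - M, by ring⟩
  obtain ⟨n4, e4⟩ : ∃ n : ℤ, (c 4 : ℤ) = M + n := ⟨c 4 - M, by ring⟩
  have hs' : n0 + n1 + n2 + n3 + n4 = 0 := by
    have : (c 0 : ℤ) + c 1 + c 2 + c 3 + c 4 = 5 * M := by exact_mod_cast hs
    linarith
  have key : 2 * ((abacusSum c : ℤ) - (5 * M).choose 2) =
      n0 * (5 * n0 - 4) + n1 * (5 * n1 - 2) + n2 * (5 * n2) + n3 * (5 * n3 + 2) +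
        n4 * (5 * n4 + 4) := by
    rw [mul_sub, hN, hW]
    push_cast
    rw [e0] at h0; rw [e1] at h1; rw [e2] at h2; rw [e3] at h3; rw [e4] at h4
    rw [e1, e2, e3, e4]
    linear_combination 5 * h0 + 5 * h1 + 5 * h2 + 5 * h3 + 5 * h4 + (10 * M - 1) * hs'
  have b : ∀ n k : ℤ, -4 ≤ k → k ≤ 4 → |n| ≤ n * (5 * n + k) := by
    intro n k hk1 hk2
    rcases lt_trichotomy n 0 with h | h | h
    · rw [abs_of_neg h]; nlinarith
    · simp [h]
    · rw [abs_of_pos h]; nlinarith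
  have b0 := b n0 (-4) (by norm_num) (by norm_num)
  have b1 := b n1 (-2) (by norm_num) (by norm_num)
  have b2 := b n2 0 (by norm_num) (by norm_num)
  have b3 := b n3 2 (by norm_num) (by norm_num)
  have b4 := b n4 4 (by norm_num) (by norm_num)
  rw [← sub_eq_add_neg] at b0 b1
  rw [add_zero] at b2
  have a0 := neg_abs_le n0
  have a1 := neg_abs_le n1
  have a2 := neg_abs_le n2
  have a3 := neg_abs_le n3
  have a4 := neg_abs_le n4
  have p0 := abs_nonneg n0
  have p1 := abs_nonneg n1
  have p2 := abs_nonneg n2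
  have p3 := abs_nonneg n3
  have p4 := abs_nonneg n4
  have hle : (5 * M).choose 2 ≤ abacusSum c := by zify; linarith
  refine ⟨hle, fun i ↦ ?_⟩
  zify [hle]
  fin_cases i <;> simp only [Fin.zero_eta, Fin.mk_one, Fin.reduceFinMk] <;> linarith

theorem X_pow_dvd_prod_sub_pentagonalSeries (k : ℕ) :
    (X : (ZMod 5)⟦X⟧) ^ (k + 1) ∣
      ∏ i ∈ range k, (1 - X ^ (i + 1)) - pentagonalSeries (ZMod 5) := by
  rw [X_pow_dvd_iff]
  intro m hm
  obtain ⟨s, hs⟩ := Filter.eventually_atTop.mp (coeff_prod_one_sub_X_pow_eventually_eq (ZMod 5) m)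
  have stable : ∀ l, coeff m (∏ i ∈ range (k + l), (1 - X ^ (i + 1)) : (ZMod 5)⟦X⟧) =
      coeff m (∏ i ∈ range k, (1 - X ^ (i + 1)) : (ZMod 5)⟦X⟧) := by
    intro l
    induction l with
    | zero => rfl
    | succ l ih =>
      rw [← add_assoc, prod_range_succ, mul_sub, mul_one, map_sub, ih, coeff_mul_X_pow',
        if_neg (by omega), sub_zero]
  have h1 := hs (range (k + (s.sup id + 1))) (by
    intro x hx
    have := le_sup (f := id) hx
    simp only [id_eq] at this
    simp only [mem_range]; omega)
  rw [map_sub, ← h1, stable, sub_self]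

theorem constantCoeff_prod_one_sub_X_pow (k : ℕ) :
    constantCoeff (∏ i ∈ range k, (1 - X ^ (i + 1)) : (ZMod 5)⟦X⟧) = 1 := by
  rw [map_prod]
  exact prod_eq_one fun i _ ↦ by simp

theorem constantCoeff_pentagonalSeries : constantCoeff (pentagonalSeries (ZMod 5)) = 1 := by
  have := coeff_pentagonalSeries_pentagonal (ZMod 5) 0
  simpa [pentagonal] using this

theorem pow_dvd_inv_sub_inv {k : ℕ} {f g : (ZMod 5)⟦X⟧} (hf : constantCoeff f = 1)
    (hg : constantCoeff g = 1) (h : X ^ k ∣ f - g) : X ^ k ∣ f⁻¹ - g⁻¹ := by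
  have hf' := PowerSeries.mul_inv_cancel f (by simp [hf])
  have hg' := PowerSeries.mul_inv_cancel g (by simp [hg])
  have : f⁻¹ - g⁻¹ = (f - g) * (-(f⁻¹ * g⁻¹)) := by
    linear_combination -f⁻¹ * hg' + g⁻¹ * hf'
  rw [this]
  exact h.mul_right _

theorem dvd_prod_sub_pow_card {R ι : Type*} [CommRing R] (s : Finset ι) {x y : R} {f : ι → R}
    (h : ∀ i ∈ s, x ∣ f i - y) : x ∣ ∏ i ∈ s, f i - y ^ #s := by
  classical
  induction s using Finset.induction_on with
  | empty => simp
  | insert a s ha ih =>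
    rw [prod_insert ha, card_insert_of_notMem ha]
    have h1 := ih fun i hi ↦ h i (mem_insert_of_mem hi)
    have h2 := h a (mem_insert_self a s)
    have : f a * ∏ i ∈ s, f i - y ^ (#s + 1) =
        f a * (∏ i ∈ s, f i - y ^ #s) + (f a - y) * y ^ #s := by ring
    rw [this]
    exact dvd_add (h1.mul_left _) (h2.mul_right _)

theorem mk_eq_pentagonalSeries_pow {a : ℕ → ℕ}
    (ha : ∀ m N, m ≤ N → a m = #{c ∈ finsuppAntidiag (univ : Finset (Fin 5)) N |
      abacusSum c = N.choose 2 + m}) :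
    (mk fun m ↦ (a m : ZMod 5)) = pentagonalSeries (ZMod 5) ^ 24 := by
  set F : (ZMod 5)⟦X⟧ := mk fun m ↦ (a m : ZMod 5) with hF
  set E := pentagonalSeries (ZMod 5) with hE
  set P : ℕ → (ZMod 5)⟦X⟧ := fun k ↦ ∏ i ∈ range k, (1 - X ^ (i + 1)) with hP
  have hE0 : constantCoeff E = 1 := constantCoeff_pentagonalSeries
  have hP0 : ∀ k, constantCoeff (P k) = 1 := constantCoeff_prod_one_sub_X_pow
  have hE' := PowerSeries.mul_inv_cancel E (by simp [hE0])
  have hP' : ∀ k, P k * (P k)⁻¹ = 1 := fun k ↦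
    PowerSeries.mul_inv_cancel (P k) (by simp [hP0])
  have hD : ∀ k, (P (k + 1))⁻¹ * (1 - X ^ (k + 1)) = (P k)⁻¹ := by
    intro k
    have h1 : P (k + 1) = P k * (1 - X ^ (k + 1)) := prod_range_succ _ _
    have h2 := hP' (k + 1)
    rw [h1] at h2 ⊢
    linear_combination (P k)⁻¹ * h2 - (P k * (1 - X ^ (k + 1)))⁻¹ * (1 - X ^ (k + 1)) * hP' k
  have hexp : ∀ k, X ^ (k + 1) ∣
      expand 5 (by norm_num) (P k)⁻¹ - expand 5 (by norm_num) E⁻¹ := by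
    intro k
    obtain ⟨r, hr⟩ := pow_dvd_inv_sub_inv (hP0 k) hE0 (X_pow_dvd_prod_sub_pentagonalSeries k)
    rw [← map_sub, hr, map_mul, map_pow, expand_X, ← pow_mul]
    exact (pow_dvd_pow X (by omega)).mul_right _
  have main : ∀ m, X ^ (m + 1) ∣ F * (expand 5 (by norm_num) E⁻¹) ^ 5 - E⁻¹ := by
    intro m
    set M := 3 * m + 1
    set C := (5 * M).choose 2
    set y : (ZMod 5)⟦X⟧ := expand 5 (by norm_num) E⁻¹
    have hid := sum_prod_eq_of_dissection (q := (X : (ZMod 5)⟦X⟧)) (D := fun k ↦ (P k)⁻¹)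
      (D' := fun k ↦ expand 5 (by norm_num) (P k)⁻¹) (by simp [hP]) (by simp [hP]) hD
      (fun k ↦ by
        rw [← hD k, map_mul, map_sub, map_one, map_pow, expand_X])
      (fun k ↦ by
        apply IsLeftCancelMulZero.mul_left_cancel_of_ne_zero
        intro h
        simpa using congrArg constantCoeff h) (5 * M)
    have h1 : (X : (ZMod 5)⟦X⟧) ^ (C + (m + 1)) ∣
        ∑ c ∈ finsuppAntidiag (univ : Finset (Fin 5)) (5 * M), X ^ abacusSum c *
          (∏ i, expand 5 (by norm_num) (P (c i))⁻¹ - y ^ 5) := by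
      refine dvd_sum fun c hc ↦ ?_
      obtain ⟨hb1, hb2⟩ := abacusSum_bounds hc
      by_cases hlt : C + (m + 1) ≤ abacusSum c
      · exact (pow_dvd_pow X hlt).mul_right _
      · rw [pow_add]
        refine mul_dvd_mul (pow_dvd_pow X hb1) ?_
        have := dvd_prod_sub_pow_card (univ : Finset (Fin 5)) (x := (X : (ZMod 5)⟦X⟧) ^ (m + 1))
          (y := y) (f := fun i ↦ expand 5 (by norm_num) (P (c i))⁻¹) fun i _ ↦
          (pow_dvd_pow X (by have := hb2 i; omega)).trans (hexp (c i))
        simpa using this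
    have h2 : (X : (ZMod 5)⟦X⟧) ^ (C + (m + 1)) ∣
        ∑ c ∈ finsuppAntidiag (univ : Finset (Fin 5)) (5 * M), X ^ abacusSum c - X ^ C * F := by
      rw [X_pow_dvd_iff]
      intro l hl
      rw [map_sub, map_sum, coeff_X_pow_mul']
      simp only [coeff_X_pow]
      split_ifs with hCl
      · rw [hF, coeff_mk, ha (l - C) (5 * M) (by omega), sum_boole, sub_eq_zero]
        congr 2
        refine filter_congr fun c _ ↦ ?_
        omega
      · rw [sub_zero, sum_eq_zero]
        intro c hc
        have := (abacusSum_bounds hc).1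
        rw [if_neg (by omega)]
    simp only [mul_sub, sum_sub_distrib] at h1
    rw [hid, ← sum_mul] at h1
    have h3 := dvd_add h1 (h2.mul_right (y ^ 5))
    rw [show ∀ S : (ZMod 5)⟦X⟧, X ^ C * (P (5 * M))⁻¹ - S * y ^ 5 + (S - X ^ C * F) * y ^ 5 =
      X ^ C * ((P (5 * M))⁻¹ - F * y ^ 5) by intro S; ring, pow_add] at h3
    have hX : (X : (ZMod 5)⟦X⟧) ^ C ≠ 0 := pow_ne_zero _ X_ne_zero
    have h4 := (mul_dvd_mul_iff_left hX).mp h3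
    have h5 : (X : (ZMod 5)⟦X⟧) ^ (m + 1) ∣ (P (5 * M))⁻¹ - E⁻¹ :=
      (pow_dvd_pow X (by omega)).trans
        (pow_dvd_inv_sub_inv (hP0 _) hE0 (X_pow_dvd_prod_sub_pentagonalSeries _))
    have := dvd_sub h5 h4
    rwa [sub_sub_sub_cancel_left] at this
  have hFE : F * (expand 5 (by norm_num) E⁻¹) ^ 5 = E⁻¹ := by
    rw [← sub_eq_zero]
    ext m
    rw [map_zero]
    exact (X_pow_dvd_iff.mp (main m)) m (by omega)
  have hE5 : expand 5 (by norm_num) E⁻¹ * E ^ 5 = 1 := by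
    rw [hE, pentagonalSeries_pow_five, ← map_mul, mul_comm, ← hE, hE', map_one]
  calc F = F * (expand 5 (by norm_num) E⁻¹ * E ^ 5) ^ 5 := by rw [hE5, one_pow, mul_one]
    _ = (F * (expand 5 (by norm_num) E⁻¹) ^ 5) * E ^ 25 := by ring
    _ = (E * E⁻¹) * E ^ 24 := by rw [hFE]; ring
    _ = E ^ 24 := by rw [hE', one_mul]

end CoreSeries

section BetaSets
open Finset

theorem List.lt_getD_iff_of_pairwise_ge {l : List ℕ} (hl : l.Pairwise (· ≥ ·)) (i j : ℕ) :
    j < l.getD i 0 ↔ i < l.countP (j < ·) := by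
  induction l generalizing i with
  | nil => simp
  | cons a l ih =>
    rw [List.pairwise_cons] at hl
    by_cases ha : j < a
    · rw [List.countP_cons_of_pos (by simpa using ha)]
      cases i with
      | zero => simpa using ha
      | succ i => simpa using ih hl.2 i
    · have h0 : (a :: l).countP (j < ·) = 0 := by
        rw [List.countP_eq_zero]
        intro b hb
        rcases List.mem_cons.mp hb with rfl | hb
        · simpa using ha
        · have := hl.1 b hb
          simp only [decide_eq_true_eq]; omega
      have h1 : l.countP (j < ·) = 0 := by
        rw [List.countP_cons_of_neg (by simpa using ha)] at h0
        exact h0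
      cases i with
      | zero => simpa [h0] using ha
      | succ i =>
        have := ih hl.2 i
        rw [h1] at this
        rw [h0]
        simpa using this

theorem List.filter_map_getD_range {l : List ℕ} (hl : ∀ x ∈ l, x ≠ 0) {N : ℕ}
    (hN : l.length ≤ N) : ((List.range N).map (l.getD · 0)).filter (· ≠ 0) = l := by
  induction l generalizing N with
  | nil => simp
  | cons a l ih =>
    obtain ⟨N, rfl⟩ : ∃ k, N = k + 1 := ⟨N - 1, by simp at hN; omega⟩
    have h1 := ih (fun x hx ↦ hl x (List.mem_cons_of_mem _ hx)) (N := N) (by simpa using hN)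
    have h2 := hl a List.mem_cons_self
    rw [List.range_succ_eq_map, List.map_cons, List.map_map,
      List.filter_cons_of_pos (by simpa using h2)]
    simpa [Function.comp_def] using h1

variable {n : ℕ}

/-- The `i`-th largest part of a partition, or `0` if there are at most `i` parts. -/
def Nat.Partition.row (p : n.Partition) (i : ℕ) : ℕ :=
  (p.parts.sort (· ≤ ·)).reverse.getD i 0

/-- The number of parts of a partition exceeding `j`. -/
def Nat.Partition.col (p : n.Partition) (j : ℕ) : ℕ :=
  (p.parts.filter (fun x ↦ j < x)).card

theorem Nat.Partition.lt_row_iff (p : n.Partition) (i j : ℕ) : j < p.row i ↔ i < p.col j := by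
  have h : (p.parts.sort (· ≤ ·)).reverse.Pairwise (· ≥ ·) := by
    rw [List.pairwise_reverse]
    exact p.parts.pairwise_sort (· ≤ ·)
  rw [Nat.Partition.row, List.lt_getD_iff_of_pairwise_ge h, Nat.Partition.col,
    ← Multiset.countP_eq_card_filter]
  conv_rhs => rw [← Multiset.sort_eq p.parts (· ≤ ·), Multiset.coe_countP]
  rw [List.countP_reverse]

theorem Nat.Partition.row_antitone (p : n.Partition) : Antitone p.row := fun i k h ↦
  le_of_forall_lt fun j hj ↦ by
    rw [p.lt_row_iff] at hj ⊢
    omega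

theorem Nat.Partition.card_parts_le (p : n.Partition) : p.parts.card ≤ n := by
  have h := Multiset.card_nsmul_le_sum (s := p.parts) (a := 1) fun x hx ↦ p.parts_pos hx
  rw [p.parts_sum] at h
  simpa using h

theorem Nat.Partition.col_le (p : n.Partition) (j : ℕ) : p.col j ≤ n :=
  (Multiset.card_le_card (Multiset.filter_le _ _)).trans p.card_parts_le

theorem Nat.Partition.row_eq_zero (p : n.Partition) {i : ℕ} (hi : n ≤ i) : p.row i = 0 := by
  by_contra h
  have := (p.lt_row_iff i 0).mp (Nat.pos_of_ne_zero h)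
  have := p.col_le 0
  omega

theorem Nat.Partition.filter_map_row (p : n.Partition) {N : ℕ} (hN : n ≤ N) :
    ((Multiset.range N).map p.row).filter (· ≠ 0) = p.parts := by
  have h := List.filter_map_getD_range (l := (p.parts.sort (· ≤ ·)).reverse)
    (fun x hx ↦ (p.parts_pos (by simpa using hx)).ne') (N := N)
    (by simpa using p.card_parts_le.trans hN)
  have h2 := congrArg (fun l : List ℕ ↦ (l : Multiset ℕ)) h
  simp only [Multiset.coe_reverse, Multiset.sort_eq] at h2
  rw [← h2, ← Multiset.filter_coe, ← Multiset.map_coe]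
  rfl

theorem Nat.Partition.sum_row (p : n.Partition) {N : ℕ} (hN : n ≤ N) :
    ∑ k ∈ Finset.range N, p.row k = n := by
  have h := congrArg Multiset.sum (p.filter_map_row hN)
  have h0 := (Nat.Partition.ofMultiset ((Multiset.range N).map p.row)).parts_sum
  rw [p.parts_sum] at h
  exact h0.symm.trans h

theorem Nat.Partition.ext_row {p p' : n.Partition} (h : ∀ k < n, p.row k = p'.row k) : p = p' := by
  ext1
  rw [← p.filter_map_row le_rfl, ← p'.filter_map_row le_rfl]
  congr 1
  exact Multiset.map_congr rfl fun k hk ↦ h k (Multiset.mem_range.mp hk)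

theorem Nat.Partition.exists_row_eq {r : ℕ → ℕ} (hr : Antitone r) {N : ℕ}
    (h0 : ∀ k, N ≤ k → r k = 0) (hs : ∑ k ∈ Finset.range N, r k = n) :
    ∃ p : n.Partition, p.row = r := by
  refine ⟨Nat.Partition.ofSums n ((Multiset.range N).map r) hs, ?_⟩
  set p := Nat.Partition.ofSums n ((Multiset.range N).map r) hs
  have key : ∀ i j, j < p.row i ↔ j < r i := by
    intro i j
    have hL : ((List.range N).map r).Pairwise (· ≥ ·) := by
      rw [List.pairwise_map]
      exact List.pairwise_lt_range.imp fun h ↦ hr h.le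
    have h1 := List.lt_getD_iff_of_pairwise_ge hL i j
    have h2 : ((List.range N).map r).getD i 0 = r i := by
      by_cases hi : i < N
      · simp [hi]
      · simp [hi, h0 i (by omega)]
    rw [p.lt_row_iff, ← h2, h1, Nat.Partition.col]
    have : (p.parts.filter (fun x ↦ j < x)).card = ((List.range N).map r).countP (j < ·) := by
      change (Multiset.filter _ (((Multiset.range N).map r).filter (· ≠ 0))).card = _
      rw [Multiset.filter_filter, ← Multiset.coe_countP, Multiset.countP_eq_card_filter]
      congr 1
      refine Multiset.filter_congr fun (x : ℕ) _ ↦ ?_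
      omega
    rw [this]
  funext i
  exact eq_of_forall_lt_iff fun j ↦ key i j

/-- The set of first column hook lengths of the partition with rows `r`, padded to `N` rows. -/
def betaSet (N : ℕ) (r : ℕ → ℕ) : Finset ℕ :=
  (range N).image fun k ↦ r k + (N - 1 - k)

theorem injOn_beta {r : ℕ → ℕ} (hr : Antitone r) (N : ℕ) :
    Set.InjOn (fun k ↦ r k + (N - 1 - k)) (range N) := by
  intro k hk l hl h
  simp only [coe_range, Set.mem_Iio] at hk hl h
  rcases lt_trichotomy k l with hkl | hkl | hkl
  · have := hr hkl.le
    omega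
  · exact hkl
  · have := hr hkl.le
    omega

theorem card_betaSet {r : ℕ → ℕ} (hr : Antitone r) (N : ℕ) : #(betaSet N r) = N := by
  rw [betaSet, card_image_of_injOn (injOn_beta hr N), card_range]

theorem sum_betaSet {r : ℕ → ℕ} (hr : Antitone r) (N : ℕ) :
    ∑ b ∈ betaSet N r, b = N.choose 2 + ∑ k ∈ range N, r k := by
  rw [betaSet, sum_image (injOn_beta hr N), sum_add_distrib, sum_range_reflect (fun k ↦ k),
    sum_range_id, Nat.choose_two_right, add_comm]

theorem eq_of_betaSet_eq {r r' : ℕ → ℕ} (hr : Antitone r) (hr' : Antitone r') {N : ℕ}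
    (h : betaSet N r = betaSet N r') : ∀ k < N, r k = r' k := by
  have aux : ∀ {s : ℕ → ℕ}, Antitone s → betaSet N s = betaSet N r →
      (fun i : Fin N ↦ s (N - 1 - i) + i) =
        (betaSet N r).orderEmbOfFin (card_betaSet hr N) := by
    intro s hs hsr
    refine orderEmbOfFin_unique _ (fun i ↦ ?_) fun i j hij ↦ ?_
    · rw [← hsr, betaSet, mem_image]
      exact ⟨N - 1 - i, mem_range.mpr (by omega), by omega⟩
    · have h1 := hs (show N - 1 - (j : ℕ) ≤ N - 1 - i by omega)
      have : (i : ℕ) < j := hij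
      omega
  intro k hk
  have h1 := congrFun ((aux hr rfl).trans (aux hr' h.symm).symm) ⟨N - 1 - k, by omega⟩
  simp only [show N - 1 - (N - 1 - k) = k by omega] at h1
  omega

theorem exists_betaSet_eq (B : Finset ℕ) :
    ∃ r : ℕ → ℕ, Antitone r ∧ (∀ k, #B ≤ k → r k = 0) ∧ betaSet #B r = B := by
  set N := #B with hN
  set e := B.orderEmbOfFin hN.symm
  have hle : ∀ i (hi : i < N), i ≤ e ⟨i, hi⟩ := by
    intro i
    induction i with
    | zero => simp
    | succ i ih =>
      intro hi
      have h1 := ih (by omega)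
      have h2 : e ⟨i, by omega⟩ < e ⟨i + 1, hi⟩ := e.strictMono (by simp)
      omega
  refine ⟨fun k ↦ if h : k < N then e ⟨N - 1 - k, by omega⟩ - (N - 1 - k) else 0,
    antitone_nat_of_succ_le fun k ↦ ?_, fun k hk ↦ dif_neg (by omega), ?_⟩
  · by_cases h : k + 1 < N
    · rw [dif_pos h, dif_pos (by omega)]
      have h2 : e ⟨N - 1 - (k + 1), by omega⟩ < e ⟨N - 1 - k, by omega⟩ :=
        e.strictMono (by simp only [Fin.mk_lt_mk]; omega)
      omega
    · rw [dif_neg h]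
      exact Nat.zero_le _
  · refine eq_of_subset_of_card_le (fun x hx ↦ ?_) ?_
    · obtain ⟨k, hk, rfl⟩ := mem_image.mp hx
      have hk := mem_range.mp hk
      simp only
      rw [dif_pos hk, Nat.sub_add_cancel (hle _ (by omega))]
      exact orderEmbOfFin_mem _ _ _
    · rw [betaSet, card_image_of_injOn, card_range]
      intro k hk l hl h
      simp only [coe_range, Set.mem_Iio] at hk hl
      simp only [dif_pos hk, dif_pos hl] at h
      rw [Nat.sub_add_cancel (hle _ (by omega)), Nat.sub_add_cancel (hle _ (by omega))] at h
      have := e.injective h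
      simp only [Fin.mk.injEq] at this
      omega

theorem isTCore_iff {t N : ℕ} (ht : 0 < t) (p : n.Partition) (hN : n ≤ N) :
    IsTCore t p ↔ ∀ b ∈ betaSet N p.row, t ≤ b → b - t ∈ betaSet N p.row := by
  have hook : ∀ i j, hookLength p i j = ((p.row i - j) + (p.col j - i)) - 1 := fun i j ↦ rfl
  constructor
  · intro hp b hb htb
    by_contra hx
    obtain ⟨i, hi, rfl⟩ := mem_image.mp hb
    rw [mem_range] at hi
    set x := p.row i + (N - 1 - i) - t with hxdef
    have hex : ∃ k, k = N ∨ p.row k + (N - 1 - k) ≤ x := ⟨N, Or.inl rfl⟩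
    classical
    obtain ⟨k, hk1, hk2⟩ : ∃ k, (k = N ∨ p.row k + (N - 1 - k) ≤ x) ∧
        ∀ l < k, ¬ (l = N ∨ p.row l + (N - 1 - l) ≤ x) :=
      ⟨Nat.find hex, Nat.find_spec hex, fun l ↦ Nat.find_min hex⟩
    have hkN : k ≤ N := by
      by_contra h
      exact hk2 N (by omega) (Or.inl rfl)
    have hk3 : k < N → p.row k + (N - 1 - k) < x := by
      intro h
      rcases hk1 with h1 | h1
      · omega
      · refine lt_of_le_of_ne h1 fun h2 ↦ hx ?_
        rw [← h2]
        exact mem_image_of_mem _ (mem_range.mpr h)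
    have hik : i < k := by
      by_contra h
      have h1 := p.row_antitone (not_lt.mp h)
      have := hk3 (by omega)
      omega
    have hcol1 : p.col (x - (N - k)) ≤ k := by
      rw [← not_lt, ← p.lt_row_iff]
      rcases hkN.eq_or_lt with h | h
      · rw [p.row_eq_zero (by omega)]
        omega
      · have := hk3 h
        omega
    have hcol2 : k - 1 < p.col (x - (N - k)) := by
      rw [← p.lt_row_iff]
      have := hk2 (k - 1) (by omega)
      rw [not_or] at this
      have h2 : k < N → N - k ≤ x := fun h ↦ by have := hk3 h; omega
      omega
    have hcol : p.col (x - (N - k)) = k := by omega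
    have hj : x - (N - k) < p.row i := by
      rw [p.lt_row_iff]
      omega
    refine hp i (x - (N - k)) hj ?_
    rw [hook, hcol]
    have h2 : N - k ≤ x := by
      rcases hkN.eq_or_lt with h | h
      · omega
      · have := hk3 h; omega
    rw [show p.row i - (x - (N - k)) + (k - i) - 1 = t by omega]
  · rintro hB i j hj ⟨s, hs⟩
    change j < p.row i at hj
    have hi := (p.lt_row_iff i j).mp hj
    have hc := p.col_le j
    rw [hook] at hs
    have iter : ∀ s, t * s ≤ p.row i + (N - 1 - i) →
        p.row i + (N - 1 - i) - t * s ∈ betaSet N p.row := by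
      intro s
      induction s with
      | zero => exact fun _ ↦ mem_image_of_mem _ (mem_range.mpr (by omega))
      | succ s ih =>
        intro h
        rw [mul_add, mul_one] at h ⊢
        rw [← Nat.sub_sub]
        exact hB _ (ih (by omega)) (by omega)
    obtain ⟨k, hk, hk'⟩ := mem_image.mp (iter s (by omega))
    rw [mem_range] at hk
    have := p.lt_row_iff k j
    omega

/-- The set of positions of beads on an abacus with five runners whose `i`-th runner has its `c i`
lowest positions occupied. -/
def flushSet (c : Fin 5 → ℕ) : Finset ℕ :=
  (univ.sigma fun i ↦ range (c i)).image fun x ↦ 5 * x.2 + x.1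

theorem mem_flushSet {c : Fin 5 → ℕ} {x : ℕ} :
    x ∈ flushSet c ↔ x / 5 < c (Fin.ofNat 5 x) := by
  simp only [flushSet, mem_image, mem_sigma, mem_univ, true_and, mem_range, Sigma.exists]
  constructor
  · rintro ⟨i, q, hq, rfl⟩
    have h1 : Fin.ofNat 5 (5 * q + i) = i := by
      ext
      simp only [Fin.ofNat]
      omega
    rw [h1]
    omega
  · intro h
    exact ⟨_, _, h, by simp only [Fin.ofNat]; omega⟩

theorem sum_flushSet (c : Fin 5 → ℕ) (f : ℕ → ℕ) :
    ∑ x ∈ flushSet c, f x = ∑ i : Fin 5, ∑ q ∈ range (c i), f (5 * q + i) := by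
  rw [flushSet, sum_image, sum_sigma]
  rintro ⟨i, q⟩ - ⟨j, s⟩ - h
  simp only at h
  have h1 : i = j := by ext; omega
  subst h1
  have h2 : q = s := by omega
  rw [h2]

theorem card_flushSet (c : Fin 5 → ℕ) : #(flushSet c) = ∑ i, c i := by
  rw [card_eq_sum_ones, sum_flushSet]
  simp

theorem sum_id_flushSet (c : Fin 5 →₀ ℕ) : ∑ x ∈ flushSet c, x = abacusSum c := by
  rw [sum_flushSet c fun x ↦ x, abacusSum]
  refine sum_congr rfl fun i _ ↦ ?_
  rw [sum_add_distrib, ← mul_sum, sum_range_id, ← Nat.choose_two_right, sum_const, card_range,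
    smul_eq_mul]
  ring

theorem flushSet_injective : Function.Injective flushSet := by
  intro c d h
  funext i
  refine eq_of_forall_lt_iff fun q ↦ ?_
  have h1 : Fin.ofNat 5 (5 * q + i) = i := by
    ext
    simp only [Fin.ofNat]
    omega
  have h2 := mem_flushSet (c := c) (x := 5 * q + i)
  rw [h, mem_flushSet, h1, show (5 * q + i) / 5 = q by omega] at h2
  exact h2.symm

theorem flushSet_sub_five {c : Fin 5 → ℕ} {b : ℕ} (hb : b ∈ flushSet c) (h : 5 ≤ b) :
    b - 5 ∈ flushSet c := by
  rw [mem_flushSet] at hb ⊢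
  have : Fin.ofNat 5 (b - 5) = Fin.ofNat 5 b := by
    ext
    simp only [Fin.ofNat]
    omega
  rw [this]
  omega

theorem Finset.eq_range_card {S : Finset ℕ} (h : ∀ x, x + 1 ∈ S → x ∈ S) : S = range #S := by
  refine eq_of_subset_of_card_le (fun x hx ↦ ?_) (by simp)
  have hsub : ∀ k y, y + k ∈ S → y ∈ S := by
    intro k
    induction k with
    | zero => exact fun y hy ↦ hy
    | succ k ih => exact fun y hy ↦ ih y (h _ hy)
  have : range (x + 1) ⊆ S := fun y hy ↦ hsub (x - y) y (by
    rw [mem_range] at hy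
    rwa [show y + (x - y) = x by omega])
  have := card_le_card this
  rw [card_range] at this
  rw [mem_range]
  omega

theorem exists_flushSet_eq {B : Finset ℕ} (hB : ∀ b ∈ B, 5 ≤ b → b - 5 ∈ B) :
    ∃ c, flushSet c = B := by
  have hS : ∀ (i : Fin 5) (q : ℕ), q ∈ (B.filter (fun b : ℕ ↦ b % 5 = i)).image (· / 5) ↔
      5 * q + i ∈ B := by
    intro i q
    simp only [mem_image, mem_filter]
    constructor
    · rintro ⟨b, ⟨hb, hbi⟩, rfl⟩
      rwa [show 5 * (b / 5) + i = b by omega]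
    · exact fun h ↦ ⟨_, ⟨h, by omega⟩, by omega⟩
  refine ⟨fun i ↦ #((B.filter (fun b : ℕ ↦ b % 5 = i)).image (· / 5)), ?_⟩
  ext x
  rw [mem_flushSet, ← mem_range, ← Finset.eq_range_card, hS]
  · rw [show 5 * (x / 5) + (Fin.ofNat 5 x : Fin 5) = x by simp only [Fin.ofNat]; omega]
  · intro q
    rw [hS, hS]
    intro h
    have := hB _ h (by omega)
    rwa [show 5 * (q + 1) + (Fin.ofNat 5 x : ℕ) - 5 = 5 * q + (Fin.ofNat 5 x : ℕ) by omega] at this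

open Classical in
theorem card_isTCore_five {N : ℕ} (hN : n ≤ N) :
    #{p : n.Partition | IsTCore 5 p} =
      #{c ∈ finsuppAntidiag (univ : Finset (Fin 5)) N | abacusSum c = N.choose 2 + n} := by
  have hex : ∀ p : n.Partition, IsTCore 5 p → ∃ c : Fin 5 →₀ ℕ, flushSet c = betaSet N p.row := by
    intro p hp
    obtain ⟨c, hc⟩ := exists_flushSet_eq ((isTCore_iff (by norm_num) p hN).mp hp)
    exact ⟨Finsupp.equivFunOnFinite.symm c, hc⟩
  choose c hc using hex
  refine card_bij (fun p hp ↦ c p (mem_filter.mp hp).2) (fun p hp ↦ ?_)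
    (fun p hp p' hp' h ↦ ?_) fun d hd ↦ ?_
  · have hc := hc p (mem_filter.mp hp).2
    rw [mem_filter, mem_finsuppAntidiag, ← card_flushSet, ← sum_id_flushSet, hc,
      card_betaSet p.row_antitone, sum_betaSet p.row_antitone, p.sum_row hN]
    simp
  · have h1 := hc p (mem_filter.mp hp).2
    rw [h, hc p' (mem_filter.mp hp').2] at h1
    exact (Nat.Partition.ext_row fun k hk ↦
      eq_of_betaSet_eq p'.row_antitone p.row_antitone h1 k (by omega)).symm
  · rw [mem_filter, mem_finsuppAntidiag] at hd
    obtain ⟨⟨hd1, -⟩, hd2⟩ := hd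
    rw [← card_flushSet] at hd1
    rw [← sum_id_flushSet] at hd2
    obtain ⟨r, hr1, hr2, hr3⟩ := exists_betaSet_eq (flushSet d)
    rw [hd1] at hr2 hr3
    have hsum := sum_betaSet hr1 N
    rw [hr3, hd2] at hsum
    obtain ⟨p, rfl⟩ := Nat.Partition.exists_row_eq (n := n) hr1 hr2 (by omega)
    have hp : IsTCore 5 p := by
      rw [isTCore_iff (by norm_num) p hN, hr3]
      exact fun b hb h ↦ flushSet_sub_five hb h
    refine ⟨p, by simpa using hp, ?_⟩
    exact DFunLike.coe_injective (flushSet_injective ((hc p hp).trans hr3))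

end BetaSets

section Tuples
open PowerSeries Finset

open Classical in
theorem coeff_mk_card_isTCore_pow (R : Type*) [CommRing R] (t k n : ℕ) :
    coeff n ((mk fun m ↦ (#{p : m.Partition | IsTCore t p} : R)) ^ k) = numA t k n := by
  set F : R⟦X⟧ := mk fun m ↦ (#{p : m.Partition | IsTCore t p} : R)
  set G : R⟦X⟧ := ∑ s : (Σ m : Fin (n + 1), Nat.Partition (m : ℕ)),
    if IsTCore t s.2 then X ^ (s.1 : ℕ) else 0 with hG
  have hFG : X ^ (n + 1) ∣ F - G := by
    rw [X_pow_dvd_iff]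
    intro m hm
    rw [map_sub, coeff_mk, hG, map_sum, Fintype.sum_sigma, Fintype.sum_eq_single ⟨m, hm⟩]
    · simp only [apply_ite (coeff m), coeff_X_pow_self, map_zero, sum_boole, sub_self]
    · intro l hl
      refine sum_eq_zero fun p _ ↦ ?_
      have : m ≠ l := fun h ↦ hl (Fin.ext h.symm)
      rw [apply_ite (coeff m), coeff_X_pow, if_neg this, map_zero, ite_self]
  have hpow : coeff n (F ^ k) = coeff n (G ^ k) := by
    rw [← sub_eq_zero, ← map_sub]
    exact X_pow_dvd_iff.mp (hFG.trans (sub_dvd_pow_sub_pow F G k)) n (Nat.lt_succ_self n)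
  rw [hpow, hG, Fintype.sum_pow, map_sum, numA, Nat.card_eq_fintype_card, Fintype.card_subtype,
    ← sum_boole]
  refine sum_congr rfl fun f _ ↦ ?_
  rw [prod_ite_zero, prod_pow_eq_pow_sum, apply_ite (coeff n), coeff_X_pow, map_zero, ← ite_and]
  simp only [mem_univ, true_imp_iff, and_comm, eq_comm]

end Tuples

theorem stmt_5 : ∀ n : ℕ, 5 ∣ numA 5 3 (25 * n + 22) := by
  classical
  intro n
  rw [← ZMod.natCast_eq_zero_iff, ← coeff_mk_card_isTCore_pow,
    mk_eq_pentagonalSeries_pow fun m N hN ↦ card_isTCore_five hN, ← pow_mul]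
  exact coeff_pentagonalSeries_pow_seventyTwo n
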